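/- Under the q-binomial theorem and the Jackson-integral q-beta evaluation, for 0 < q < 1 and |z| < 1: φ(q^a,q^b,q^c;q,z) = (Γ_q(c)/(Γ_q(b)Γ_q(c-b))) ∫_0^1 t^{b-1} ((tzq^a;q)_∞ (tq;q)_∞)/((tz;q)_∞ (tq^{c-b};q)_∞) d_q t, where ∫_0^1 f(t) d_q t := (1-q) Σ_{n=0}^∞ q^n f(q^n). -/

import Mathlib

/-- The finite q-Pochhammer symbol `(a;q)_k = ∏_{l=0}^{k-1} (1 - a q^l)`. -/
noncomputable def qPoch (q a : ℂ) (k : ℕ) : ℂ := ∏ l ∈ Finset.range k, (1 - a * q ^ l)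

/-- The infinite q-Pochhammer symbol `(a;q)_∞ = ∏_{k≥0} (1 - a q^k)`. -/
noncomputable def qPochInf (q a : ℂ) : ℂ := ∏' k : ℕ, (1 - a * q ^ k)

/-- The q-gamma function `Γ_q(z) = ((q;q)_∞ / (q^z;q)_∞) (1-q)^{1-z}`. -/
noncomputable def qGamma (q : ℝ) (z : ℂ) : ℂ :=
  qPochInf q (q : ℂ) / qPochInf q (Complex.exp (z * Real.log q)) *
    ((1 - q : ℂ)) ^ ((1 : ℂ) - z)

open Filter Topology

section QPochhammer

variable {q : ℂ}

lemma qPoch_succ (q a : ℂ) (k : ℕ) : qPoch q a (k + 1) = qPoch q a k * (1 - a * q ^ k) :=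
  Finset.prod_range_succ _ _

lemma summable_norm_neg_mul_pow (hq : ‖q‖ < 1) (a : ℂ) :
    Summable fun k : ℕ => ‖-(a * q ^ k)‖ := by
  simpa using (summable_geometric_of_lt_one (norm_nonneg q) hq).mul_left ‖a‖

lemma multipliable_one_sub_mul_pow (hq : ‖q‖ < 1) (a : ℂ) :
    Multipliable fun k : ℕ => 1 - a * q ^ k := by
  simpa [sub_eq_add_neg] using multipliable_one_add_of_summable (summable_norm_neg_mul_pow hq a)

lemma one_sub_mul_pow_ne_zero (hq : ‖q‖ < 1) {a : ℂ} (ha : ‖a‖ < 1) (k : ℕ) :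
    1 - a * q ^ k ≠ 0 := by
  intro h
  have hlt : ‖a * q ^ k‖ < 1 := by
    rw [norm_mul, norm_pow]
    exact (mul_le_of_le_one_right (norm_nonneg a)
      (pow_le_one₀ (norm_nonneg q) hq.le)).trans_lt ha
  rw [← sub_eq_zero.mp h, norm_one] at hlt
  exact lt_irrefl _ hlt

lemma qPoch_ne_zero (hq : ‖q‖ < 1) {a : ℂ} (ha : ‖a‖ < 1) (k : ℕ) : qPoch q a k ≠ 0 :=
  Finset.prod_ne_zero_iff.mpr fun l _ => one_sub_mul_pow_ne_zero hq ha l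

lemma qPochInf_ne_zero (hq : ‖q‖ < 1) {a : ℂ} (ha : ‖a‖ < 1) : qPochInf q a ≠ 0 := by
  have h := tprod_one_add_ne_zero_of_summable (f := fun k : ℕ => -(a * q ^ k))
    (fun k => by simpa [← sub_eq_add_neg] using one_sub_mul_pow_ne_zero hq ha k)
    (summable_norm_neg_mul_pow hq a)
  simpa [qPochInf, sub_eq_add_neg] using h

lemma tendsto_qPoch (hq : ‖q‖ < 1) (a : ℂ) :
    Tendsto (qPoch q a) atTop (𝓝 (qPochInf q a)) :=
  (multipliable_one_sub_mul_pow hq a).hasProd.tendsto_prod_nat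

/-- `(a;q)_∞ = (a;q)_n (q^n a;q)_∞`. -/
lemma qPoch_mul_qPochInf (hq : ‖q‖ < 1) (a : ℂ) (n : ℕ) :
    qPoch q a n * qPochInf q (q ^ n * a) = qPochInf q a := by
  have hshift : (fun k : ℕ => 1 - q ^ n * a * q ^ k) = fun k => 1 - a * q ^ (k + n) := by
    funext k
    ring
  have hm := multipliable_one_sub_mul_pow hq (q ^ n * a)
  rw [hshift] at hm
  rw [qPoch, qPochInf, qPochInf, hshift]
  exact hm.prod_mul_tprod_nat_mul' (f := fun k => 1 - a * q ^ k)

lemma exists_norm_qPoch_div_le (hq : ‖q‖ < 1) (a : ℂ) :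
    ∃ M : ℝ, 0 ≤ M ∧ ∀ k, ‖qPoch q a k / qPoch q q k‖ ≤ M := by
  obtain ⟨M, hM⟩ := (Metric.isBounded_range_of_tendsto _
    ((tendsto_qPoch hq a).div (tendsto_qPoch hq q) (qPochInf_ne_zero hq hq))).exists_norm_le
  have hb : ∀ k, ‖qPoch q a k / qPoch q q k‖ ≤ M := fun k => hM _ ⟨k, rfl⟩
  exact ⟨M, (norm_nonneg _).trans (hb 0), hb⟩

lemma summable_norm_qBinomial (hq : ‖q‖ < 1) (a : ℂ) {z : ℂ} (hz : ‖z‖ < 1) :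
    Summable fun k : ℕ => ‖qPoch q a k / qPoch q q k * z ^ k‖ := by
  obtain ⟨M, -, hM⟩ := exists_norm_qPoch_div_le hq a
  refine Summable.of_nonneg_of_le (fun _ => norm_nonneg _) (fun k => ?_)
    ((summable_geometric_of_lt_one (norm_nonneg z) hz).mul_left M)
  rw [norm_mul, norm_pow]
  exact mul_le_mul_of_nonneg_right (hM k) (by positivity)

lemma norm_pow_mul_lt_one (hq : ‖q‖ < 1) {z : ℂ} (hz : ‖z‖ < 1) (n : ℕ) : ‖q ^ n * z‖ < 1 := by
  rw [norm_mul, norm_pow]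
  exact (mul_le_of_le_one_left (norm_nonneg z)
    (pow_le_one₀ (norm_nonneg q) hq.le)).trans_lt hz

lemma qBinomial_functional_equation (hq : ‖q‖ < 1) (a : ℂ) {z : ℂ} (hz : ‖z‖ < 1) :
    (1 - z) * ∑' k, qPoch q a k / qPoch q q k * z ^ k =
      (1 - a * z) * ∑' k, qPoch q a k / qPoch q q k * (q * z) ^ k := by
  have hqz : ‖q * z‖ < 1 := by simpa using norm_pow_mul_lt_one hq hz 1
  have hs := (summable_norm_qBinomial hq a hz).of_norm
  have hs' := (summable_norm_qBinomial hq a hqz).of_norm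
  have hdiff := hs.tsum_sub hs'
  rw [(hs.sub hs').tsum_eq_zero_add] at hdiff
  have hterm : ∀ k : ℕ,
      qPoch q a (k + 1) / qPoch q q (k + 1) * z ^ (k + 1) -
        qPoch q a (k + 1) / qPoch q q (k + 1) * (q * z) ^ (k + 1) =
      z * (qPoch q a k / qPoch q q k * z ^ k) -
        a * z * (qPoch q a k / qPoch q q k * (q * z) ^ k) := by
    intro k
    have hrec : qPoch q a (k + 1) / qPoch q q (k + 1) * (1 - q * q ^ k) =
        qPoch q a k / qPoch q q k * (1 - a * q ^ k) := by
      rw [qPoch_succ, qPoch_succ, mul_div_mul_comm, mul_assoc,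
        div_mul_cancel₀ _ (one_sub_mul_pow_ne_zero hq hq k)]
    linear_combination z ^ (k + 1) * hrec
  simp only [hterm] at hdiff
  rw [(hs.mul_left z).tsum_sub (hs'.mul_left (a * z)), tsum_mul_left, tsum_mul_left] at hdiff
  simp only [pow_zero, sub_self, zero_add] at hdiff
  linear_combination -hdiff

lemma qPoch_mul_tsum_qBinomial (hq : ‖q‖ < 1) (a : ℂ) {z : ℂ} (hz : ‖z‖ < 1) (n : ℕ) :
    qPoch q z n * ∑' k, qPoch q a k / qPoch q q k * z ^ k =
      qPoch q (a * z) n * ∑' k, qPoch q a k / qPoch q q k * (q ^ n * z) ^ k := by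
  induction n with
  | zero => simp [qPoch]
  | succ n ih =>
    have h := qBinomial_functional_equation hq a (norm_pow_mul_lt_one hq hz n)
    rw [qPoch_succ, qPoch_succ, pow_succ' q n, mul_assoc q]
    linear_combination (1 - z * q ^ n) * ih + qPoch q (a * z) n * h

/-- The **q-binomial theorem**. -/
theorem tsum_qBinomial (hq : ‖q‖ < 1) (a : ℂ) {z : ℂ} (hz : ‖z‖ < 1) :
    ∑' k, qPoch q a k / qPoch q q k * z ^ k = qPochInf q (a * z) / qPochInf q z := by
  have hlim : Tendsto (fun n : ℕ => ∑' k, qPoch q a k / qPoch q q k * (q ^ n * z) ^ k) atTop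
      (𝓝 (∑' k, qPoch q a k / qPoch q q k * (0 : ℂ) ^ k)) := by
    refine tendsto_tsum_of_dominated_convergence (summable_norm_qBinomial hq a hz)
      (fun k => ?_) (Eventually.of_forall fun n k => ?_)
    · have h0 : Tendsto (fun n : ℕ => q ^ n * z) atTop (𝓝 0) := by
        simpa using (tendsto_pow_atTop_nhds_zero_of_norm_lt_one hq).mul_const z
      exact (h0.pow k).const_mul _
    · rw [norm_mul, norm_mul, norm_pow, norm_pow]
      refine mul_le_mul_of_nonneg_left (pow_le_pow_left₀ (norm_nonneg _) ?_ k) (norm_nonneg _)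
      rw [norm_mul, norm_pow]
      exact mul_le_of_le_one_left (norm_nonneg z) (pow_le_one₀ (norm_nonneg q) hq.le)
  have hzero : ∑' k, qPoch q a k / qPoch q q k * (0 : ℂ) ^ k = 1 := by
    rw [tsum_eq_single 0 fun k hk => by simp [hk]]
    simp [qPoch]
  rw [hzero] at hlim
  have hright := (tendsto_qPoch hq (a * z)).mul hlim
  simp only [← qPoch_mul_tsum_qBinomial hq a hz] at hright
  have heq := tendsto_nhds_unique ((tendsto_qPoch hq z).mul_const _) hright
  rw [eq_div_iff (qPochInf_ne_zero hq hz)]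
  linear_combination heq

/-- The Jackson-integral q-beta evaluation, in the parameters `β = q^b`, `δ = q^{c-b}`. -/
lemma tsum_qBeta (hq : ‖q‖ < 1) {β δ : ℂ} (hβ : ‖β‖ < 1) (hδ : ‖δ‖ < 1) (k : ℕ) :
    ∑' n : ℕ, qPoch q δ n / qPoch q q n * (q ^ k * β) ^ n =
      qPochInf q (δ * β) / qPochInf q β * (qPoch q β k / qPoch q (δ * β) k) := by
  have hδβ : ‖δ * β‖ < 1 := by
    rw [norm_mul]
    exact (mul_le_of_le_one_left (norm_nonneg β) hδ.le).trans_lt hβ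
  rw [tsum_qBinomial hq δ (norm_pow_mul_lt_one hq hβ k), ← qPoch_mul_qPochInf hq β k,
    ← qPoch_mul_qPochInf hq (δ * β) k, mul_left_comm δ]
  have h1 := qPoch_ne_zero hq hβ k
  have h2 := qPoch_ne_zero hq hδβ k
  have h3 := qPochInf_ne_zero hq (norm_pow_mul_lt_one hq hβ k)
  field_simp

/-- The Euler-type representation in the parameters `α = q^a`, `β = q^b`, `δ = q^{c-b}`. -/
theorem tsum_qHypergeometric (hq : ‖q‖ < 1) (α : ℂ) {β δ z : ℂ} (hβ : ‖β‖ < 1) (hδ : ‖δ‖ < 1)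
    (hz : ‖z‖ < 1) :
    ∑' k : ℕ, qPoch q α k * qPoch q β k / (qPoch q (δ * β) k * qPoch q q k) * z ^ k =
      qPochInf q β * qPochInf q δ / (qPochInf q (δ * β) * qPochInf q q) *
        ∑' n : ℕ, β ^ n * (qPochInf q (q ^ n * z * α) * qPochInf q (q ^ n * q)) /
          (qPochInf q (q ^ n * z) * qPochInf q (q ^ n * δ)) := by
  have hδβ : ‖δ * β‖ < 1 := by
    rw [norm_mul]
    exact (mul_le_of_le_one_left (norm_nonneg β) hδ.le).trans_lt hβ
  have hβ0 := qPochInf_ne_zero hq hβ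
  have hδ0 := qPochInf_ne_zero hq hδ
  have hδβ0 := qPochInf_ne_zero hq hδβ
  have hq0 := qPochInf_ne_zero hq hq
  let f : ℕ → ℕ → ℂ := fun n k =>
    qPoch q α k / qPoch q q k * z ^ k * (qPoch q δ n / qPoch q q n * (q ^ k * β) ^ n)
  have hf : Summable (Function.uncurry f) := by
    obtain ⟨M, hM0, hM⟩ := exists_norm_qPoch_div_le hq α
    obtain ⟨N, hN0, hN⟩ := exists_norm_qPoch_div_le hq δ
    have hgeom := Summable.mul_of_nonneg
      ((summable_geometric_of_lt_one (norm_nonneg β) hβ).mul_left N)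
      ((summable_geometric_of_lt_one (norm_nonneg z) hz).mul_left M)
      (fun _ => by positivity) (fun _ => by positivity)
    refine Summable.of_norm_bounded hgeom fun p => ?_
    obtain ⟨n, k⟩ := p
    have hle : ‖(q ^ k * β) ^ n‖ ≤ ‖β‖ ^ n := by
      rw [norm_pow, norm_mul, norm_pow]
      exact pow_le_pow_left₀ (by positivity)
        (mul_le_of_le_one_left (norm_nonneg β) (pow_le_one₀ (norm_nonneg q) hq.le)) n
    simp only [Function.uncurry_apply_pair, f]
    rw [mul_comm, norm_mul, norm_mul, norm_mul (qPoch q α k / qPoch q q k), norm_pow z]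
    gcongr
    · exact hN n
    · exact hM k
  have hrow : ∀ n, β ^ n * (qPochInf q (q ^ n * z * α) * qPochInf q (q ^ n * q)) /
      (qPochInf q (q ^ n * z) * qPochInf q (q ^ n * δ)) =
      qPochInf q q / qPochInf q δ * ∑' k, f n k := by
    intro n
    have hfn : ∀ k, f n k = qPoch q δ n / qPoch q q n * β ^ n *
        (qPoch q α k / qPoch q q k * (q ^ n * z) ^ k) := by
      intro k
      simp only [f, mul_pow, ← pow_mul, mul_comm k n]
      ring
    simp only [hfn]
    rw [tsum_mul_left, tsum_qBinomial hq α (norm_pow_mul_lt_one hq hz n), mul_comm α,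
      ← qPoch_mul_qPochInf hq q n, ← qPoch_mul_qPochInf hq δ n]
    have h1 := qPoch_ne_zero hq hq n
    have h2 := qPoch_ne_zero hq hδ n
    have h3 := qPochInf_ne_zero hq (norm_pow_mul_lt_one hq hz n)
    have h4 := qPochInf_ne_zero hq (norm_pow_mul_lt_one hq hδ n)
    field_simp
  simp only [hrow]
  rw [tsum_mul_left, ← hf.tsum_comm, ← tsum_mul_left, ← tsum_mul_left]
  refine tsum_congr fun k => ?_
  simp only [f]
  rw [tsum_mul_left, tsum_qBeta hq hβ hδ k]
  have h1 := qPoch_ne_zero hq hq k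
  have h2 := qPoch_ne_zero hq hδβ k
  field_simp

end QPochhammer

lemma norm_exp_mul_log_lt_one {q : ℝ} (hq0 : 0 < q) (hq1 : q < 1) {s : ℂ} (hs : 0 < s.re) :
    ‖Complex.exp (s * Real.log q)‖ < 1 := by
  rw [Complex.norm_exp, Complex.re_mul_ofReal, Real.exp_lt_one_iff]
  exact mul_neg_of_pos_of_neg hs (Real.log_neg hq0 hq1)

lemma qGamma_div_mul_one_sub {q : ℝ} (hq0 : 0 < q) (hq1 : q < 1) {b c : ℂ} (hb : 0 < b.re)
    (hcb : 0 < (c - b).re) :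
    qGamma q c / (qGamma q b * qGamma q (c - b)) * (1 - (q : ℂ)) =
      qPochInf q (Complex.exp (b * Real.log q)) * qPochInf q (Complex.exp ((c - b) * Real.log q)) /
        (qPochInf q (Complex.exp (c * Real.log q)) * qPochInf q (q : ℂ)) := by
  have hq : ‖(q : ℂ)‖ < 1 := by simpa [abs_of_pos hq0] using hq1
  have hc : 0 < c.re := by
    rw [Complex.sub_re] at hcb
    linarith
  have hβ := qPochInf_ne_zero hq (norm_exp_mul_log_lt_one hq0 hq1 hb)
  have hδ := qPochInf_ne_zero hq (norm_exp_mul_log_lt_one hq0 hq1 hcb)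
  have hγ := qPochInf_ne_zero hq (norm_exp_mul_log_lt_one hq0 hq1 hc)
  have hqq := qPochInf_ne_zero hq hq
  have h1q : (1 - q : ℂ) ≠ 0 := by
    rw [sub_ne_zero]
    exact_mod_cast hq1.ne'
  have hpow : (1 - q : ℂ) ^ (1 - b) * (1 - q : ℂ) ^ (1 - (c - b)) =
      (1 - q : ℂ) ^ (1 - c) * (1 - q : ℂ) := by
    nth_rewrite 4 [← Complex.cpow_one (1 - q : ℂ)]
    rw [← Complex.cpow_add _ _ h1q, ← Complex.cpow_add _ _ h1q]
    ring_nf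
  have hb0 : (1 - q : ℂ) ^ (1 - b) ≠ 0 := by simp [Complex.cpow_eq_zero_iff, h1q]
  have hcb0 : (1 - q : ℂ) ^ (1 - (c - b)) ≠ 0 := by simp [Complex.cpow_eq_zero_iff, h1q]
  simp only [qGamma]
  generalize (1 - q : ℂ) ^ (1 - b) = x at *
  generalize (1 - q : ℂ) ^ (1 - (c - b)) = y at *
  generalize (1 - q : ℂ) ^ (1 - c) = w at *
  generalize qPochInf q (Complex.exp (b * Real.log q)) = β at *
  generalize qPochInf q (Complex.exp ((c - b) * Real.log q)) = δ at *
  generalize qPochInf q (Complex.exp (c * Real.log q)) = γ at *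
  field_simp
  linear_combination -hpow

lemma pow_mul_exp_sub_one_mul_log {q : ℝ} (hq0 : 0 < q) (b : ℂ) (n : ℕ) :
    (q : ℂ) ^ n * Complex.exp ((b - 1) * Real.log (q ^ n)) =
      Complex.exp (b * Real.log q) ^ n := by
  have hexp : (q : ℂ) = Complex.exp (Real.log q) := by
    rw [← Complex.ofReal_exp, Real.exp_log hq0]
  rw [hexp, ← Complex.exp_nat_mul, ← Complex.exp_nat_mul, ← Complex.exp_add, Real.log_pow]
  congr 1
  push_cast
  ring


/-- Euler-type Jackson-integral representation of the basic hypergeometric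
series: `φ(q^a,q^b,q^c;q,z) = (Γ_q(c)/(Γ_q(b)Γ_q(c-b))) ∫_0^1 t^{b-1}
((tzq^a;q)_∞ (tq;q)_∞)/((tz;q)_∞ (tq^{c-b};q)_∞) d_q t`, where the Jackson
integral is `∫_0^1 f(t) d_q t = (1-q) Σ_{n≥0} q^n f(q^n)`. -/
theorem euler_jackson_representation (q : ℝ) (hq0 : 0 < q) (hq1 : q < 1)
    (a b c z : ℂ) (hb : 0 < b.re) (hcb : 0 < (c - b).re)
    (hc : ∀ n : ℕ, Complex.exp ((c + n) * Real.log q) ≠ 1) (hz : ‖z‖ < 1) :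
    ∑' k : ℕ,
        qPoch q (Complex.exp (a * Real.log q)) k * qPoch q (Complex.exp (b * Real.log q)) k /
          (qPoch q (Complex.exp (c * Real.log q)) k * qPoch q (q : ℂ) k) * z ^ k
      = qGamma q c / (qGamma q b * qGamma q (c - b)) *
          ((1 - (q : ℂ)) * ∑' n : ℕ, (q : ℂ) ^ n *
            (Complex.exp ((b - 1) * Real.log (q ^ n)) *
              (qPochInf q ((q : ℂ) ^ n * z * Complex.exp (a * Real.log q)) *
                qPochInf q ((q : ℂ) ^ n * (q : ℂ))) /
              (qPochInf q ((q : ℂ) ^ n * z) *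
                qPochInf q ((q : ℂ) ^ n * Complex.exp ((c - b) * Real.log q))))) := by
  have hq : ‖(q : ℂ)‖ < 1 := by simpa [abs_of_pos hq0] using hq1
  have hγ : Complex.exp (c * Real.log q) =
      Complex.exp ((c - b) * Real.log q) * Complex.exp (b * Real.log q) := by
    rw [← Complex.exp_add]
    ring_nf
  rw [← mul_assoc, qGamma_div_mul_one_sub hq0 hq1 hb hcb, hγ,
    tsum_qHypergeometric hq _ (norm_exp_mul_log_lt_one hq0 hq1 hb)
      (norm_exp_mul_log_lt_one hq0 hq1 hcb) hz]
  congr 1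
  refine tsum_congr fun n => ?_
  rw [← pow_mul_exp_sub_one_mul_log hq0 b n]
  ring
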